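/- Let Y_1, ..., Y_k be independent random variables on a probability space, each Y_i taking values in some measurable space. Suppose Z = \sum_{i=1}^k w_i \xi_i(Y_i), where each \xi_i is a {0,1}-valued measurable function, the weights w_i are nonnegative with w_max = max_i w_i > 0, and W := E[Z] satisfies W \ge w_max. Further, let E be a finite set of m \ge 9 edges with capacities c(e) > 0, and for each e \in E let X_e = \sum_{i=1}^k g_{e,i}(Y_i), where each g_{e,i} is measurable with values in [0, c(e)] and E[X_e] \le c(e). Then the probability that simultaneously Z \ge W/2 and X_e \le (3 \ln m / \ln \ln m) \cdot c(e) for every e \in E is at least 0.1. -/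

import Mathlib

open MeasureTheory ProbabilityTheory

lemma exp_mul_le_one_add_mul {s x : ℝ} (hx : x ∈ Set.Icc (0 : ℝ) 1) :
    Real.exp (s * x) ≤ 1 + (Real.exp s - 1) * x := by
  have h := convexOn_exp.2 (Set.mem_univ 0) (Set.mem_univ s)
    (sub_nonneg.2 hx.2) hx.1 (by ring)
  simp only [smul_eq_mul, mul_zero, zero_add, Real.exp_zero, mul_one] at h
  rw [mul_comm s x]
  linarith

section Chernoff

variable {Ω ι : Type*} [MeasurableSpace Ω] {μ : Measure Ω} [IsProbabilityMeasure μ]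

lemma integrable_of_mem_Icc {X : Ω → ℝ} (hX : Measurable X) {a b : ℝ}
    (h : ∀ ω, X ω ∈ Set.Icc a b) : Integrable X μ :=
  Integrable.of_mem_Icc a b hX.aemeasurable (ae_of_all _ h)

lemma integrable_exp_mul_of_mem_Icc_zero_one {X : Ω → ℝ} (hX : Measurable X)
    (h : ∀ ω, X ω ∈ Set.Icc (0 : ℝ) 1) (s : ℝ) :
    Integrable (fun ω ↦ Real.exp (s * X ω)) μ := by
  refine integrable_of_mem_Icc (a := 0) (b := Real.exp |s|) (by fun_prop) fun ω ↦
    ⟨(Real.exp_pos _).le, Real.exp_le_exp.2 ?_⟩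
  calc s * X ω ≤ |s| * X ω := mul_le_mul_of_nonneg_right (le_abs_self s) (h ω).1
    _ ≤ |s| := mul_le_of_le_one_right (abs_nonneg s) (h ω).2

lemma mgf_le_of_mem_Icc_zero_one {X : Ω → ℝ} (hX : Measurable X)
    (h : ∀ ω, X ω ∈ Set.Icc (0 : ℝ) 1) (s : ℝ) :
    mgf X μ s ≤ Real.exp ((Real.exp s - 1) * ∫ ω, X ω ∂μ) := by
  have hi : Integrable X μ := integrable_of_mem_Icc hX h
  calc mgf X μ s ≤ ∫ ω, (1 + (Real.exp s - 1) * X ω) ∂μ :=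
        integral_mono (integrable_exp_mul_of_mem_Icc_zero_one hX h s)
          ((integrable_const _).add (hi.const_mul _)) fun ω ↦ exp_mul_le_one_add_mul (h ω)
    _ = (Real.exp s - 1) * ∫ ω, X ω ∂μ + 1 := by
        rw [integral_add (integrable_const _) (hi.const_mul _), integral_const_mul]
        simp [add_comm]
    _ ≤ _ := Real.add_one_le_exp _

lemma mgf_sum_le_of_mem_Icc_zero_one [Fintype ι] {X : ι → Ω → ℝ} (hind : iIndepFun X μ)
    (hX : ∀ i, Measurable (X i)) (h : ∀ i ω, X i ω ∈ Set.Icc (0 : ℝ) 1) (s : ℝ) :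
    mgf (∑ i, X i) μ s ≤ Real.exp ((Real.exp s - 1) * ∫ ω, ∑ i, X i ω ∂μ) := by
  rw [hind.mgf_sum hX, integral_finsetSum _ fun i _ ↦ integrable_of_mem_Icc (hX i) (h i),
    Finset.mul_sum, Real.exp_sum]
  exact Finset.prod_le_prod (fun _ _ ↦ mgf_nonneg) fun i _ ↦
    mgf_le_of_mem_Icc_zero_one (hX i) (h i) s

lemma integrable_exp_mul_sum_of_mem_Icc_zero_one [Fintype ι] {X : ι → Ω → ℝ}
    (hind : iIndepFun X μ) (hX : ∀ i, Measurable (X i))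
    (h : ∀ i ω, X i ω ∈ Set.Icc (0 : ℝ) 1) (s : ℝ) :
    Integrable (fun ω ↦ Real.exp (s * (∑ i, X i) ω)) μ :=
  hind.integrable_exp_mul_sum hX fun i _ ↦ integrable_exp_mul_of_mem_Icc_zero_one (hX i) (h i) s

/-- Multiplicative Chernoff bound, upper tail. -/
lemma measureReal_sum_ge_le [Fintype ι] {X : ι → Ω → ℝ} (hind : iIndepFun X μ)
    (hX : ∀ i, Measurable (X i)) (h : ∀ i ω, X i ω ∈ Set.Icc (0 : ℝ) 1)
    (hmean : ∫ ω, ∑ i, X i ω ∂μ ≤ 1) {t : ℝ} (ht : 1 ≤ t) :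
    μ.real {ω | t ≤ ∑ i, X i ω} ≤ Real.exp (-(t * (Real.log t - 1)) - 1) := by
  have hb := measure_ge_le_exp_mul_mgf (μ := μ) (X := ∑ i, X i) t (Real.log_nonneg ht)
    (integrable_exp_mul_sum_of_mem_Icc_zero_one hind hX h _)
  simp only [Finset.sum_apply] at hb
  refine (hb.trans (mul_le_mul_of_nonneg_left
    (mgf_sum_le_of_mem_Icc_zero_one hind hX h _) (Real.exp_pos _).le)).trans ?_
  rw [← Real.exp_add, Real.exp_le_exp, Real.exp_log (by linarith)]
  nlinarith [mul_le_mul_of_nonneg_left hmean (sub_nonneg.2 ht)]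

/-- Multiplicative Chernoff bound for falling below half the mean. -/
lemma measureReal_sum_le_half_le [Fintype ι] {X : ι → Ω → ℝ} (hind : iIndepFun X μ)
    (hX : ∀ i, Measurable (X i)) (h : ∀ i ω, X i ω ∈ Set.Icc (0 : ℝ) 1) :
    μ.real {ω | ∑ i, X i ω ≤ (∫ ω, ∑ i, X i ω ∂μ) / 2} ≤
      Real.exp (-((1 - Real.log 2) / 2 * ∫ ω, ∑ i, X i ω ∂μ)) := by
  have hb := measure_le_le_exp_mul_mgf (μ := μ) (X := ∑ i, X i) (t := -Real.log 2)
    ((∫ ω, ∑ i, X i ω ∂μ) / 2) (by linarith [Real.log_pos one_lt_two])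
    (integrable_exp_mul_sum_of_mem_Icc_zero_one hind hX h _)
  simp only [Finset.sum_apply] at hb
  refine (hb.trans (mul_le_mul_of_nonneg_left
    (mgf_sum_le_of_mem_Icc_zero_one hind hX h _) (Real.exp_pos _).le)).trans ?_
  rw [← Real.exp_add, Real.exp_le_exp, Real.exp_neg, Real.exp_log two_pos]
  linarith

end Chernoff

lemma one_lt_log_of_nine_le {x : ℝ} (hx : 9 ≤ x) : 1 < Real.log x := by
  rw [Real.lt_log_iff_exp_lt (by linarith)]
  linarith [Real.exp_one_lt_d9]

lemma one_le_three_mul_div_log {x : ℝ} (hx : 1 < x) : 1 ≤ 3 * x / Real.log x := by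
  rw [le_div_iff₀ (Real.log_pos hx)]
  linarith [Real.log_le_sub_one_of_pos (zero_lt_one.trans hx)]

lemma two_mul_le_mul_log_sub_one {x : ℝ} (hx : 1 < x) :
    2 * x ≤ 3 * x / Real.log x * (Real.log (3 * x / Real.log x) - 1) := by
  have hx0 : 0 < x := zero_lt_one.trans hx
  have hL := Real.log_pos hx
  have h1 := Real.log_le_sub_one_of_pos (div_pos hL (zero_lt_three (α := ℝ)))
  rw [Real.log_div hL.ne' (by norm_num)] at h1
  have h2 : 2 * Real.log x / 3 ≤ Real.log (3 * x / Real.log x) - 1 := by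
    rw [Real.log_div (by positivity) hL.ne', Real.log_mul (by norm_num) hx0.ne']
    linarith
  calc 2 * x = 3 * x / Real.log x * (2 * Real.log x / 3) := by field_simp
    _ ≤ _ := mul_le_mul_of_nonneg_left h2 (by positivity)

lemma card_mul_exp_le {x : ℝ} (hx : 9 ≤ x) :
    x * Real.exp (-(2 * Real.log x) - 1) ≤ 0.0411 := by
  have hx0 : 0 < x := by linarith
  have h : x * Real.exp (-(2 * Real.log x) - 1) = (x * Real.exp 1)⁻¹ := by
    rw [show -(2 * Real.log x) - 1 = -(Real.log x + Real.log x + 1) by ring, Real.exp_neg,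
      Real.exp_add, Real.exp_add, Real.exp_log hx0]
    field_simp
  rw [h]
  refine inv_le_of_inv_le₀ (by norm_num) ?_
  nlinarith [Real.exp_one_gt_d9]

lemma exp_neg_half_one_sub_log_two_mul_le {x : ℝ} (hx : 1 ≤ x) :
    Real.exp (-((1 - Real.log 2) / 2 * x)) ≤ 0.8585 := by
  have h2 := Real.log_two_lt_d9
  have h3 : 0.1534 ≤ (1 - Real.log 2) / 2 * x := by nlinarith
  have h4 := Real.quadratic_le_exp_of_nonneg (x := 0.1534) (by norm_num)
  have h5 : Real.exp (-((1 - Real.log 2) / 2 * x)) ≤ Real.exp (-0.1534) :=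
    Real.exp_le_exp.2 (by linarith)
  refine h5.trans ?_
  rw [Real.exp_neg]
  exact inv_le_of_inv_le₀ (by norm_num) (le_trans (by norm_num) h4)

/-- Randomized rounding succeeds with probability at least `0.1`: with `Z = ∑ i, w i * ξ i (Y i)`
for independent `Y i`, `{0,1}`-valued measurable `ξ i`, nonnegative weights with positive maximum
`wmax ≤ W = E[Z]`, and for each of `m ≥ 9` edges `e` a load `X e = ∑ i, g e i (Y i)` with
`g e i` taking values in `[0, c e]` and `E[X e] ≤ c e`, the probability that simultaneously
`Z ≥ W/2` and every edge load is at most `(3 ln m / ln ln m) * c e` is at least `0.1`. -/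
theorem rounding_success_probability
    {Ω : Type*} [MeasureSpace Ω] [IsProbabilityMeasure (ℙ : Measure Ω)]
    (k : ℕ) {β : Fin k → Type*} [∀ i, MeasurableSpace (β i)]
    (Y : ∀ i, Ω → β i)
    (hYmeas : ∀ i, Measurable (Y i))
    (hYind : iIndepFun Y ℙ)
    (ξ : ∀ i, β i → ℝ)
    (hξmeas : ∀ i, Measurable (ξ i))
    (hξval : ∀ i x, ξ i x = 0 ∨ ξ i x = 1)
    (w : Fin k → ℝ) (hw : ∀ i, 0 ≤ w i)
    (wmax : ℝ) (hwmax_ub : ∀ i, w i ≤ wmax) (hwmax_mem : ∃ i, w i = wmax)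
    (hwmax_pos : 0 < wmax)
    (W : ℝ) (hW : W = ∫ ω, (∑ i, w i * ξ i (Y i ω)) ∂ℙ)
    (hWwmax : wmax ≤ W)
    {E : Type*} [Fintype E] (m : ℕ) (hm : m = Fintype.card E) (hm9 : 9 ≤ m)
    (c : E → ℝ) (hc : ∀ e, 0 < c e)
    (g : E → ∀ i, β i → ℝ)
    (hgmeas : ∀ e i, Measurable (g e i))
    (hgval : ∀ e i x, g e i x ∈ Set.Icc (0 : ℝ) (c e))
    (hgexp : ∀ e, (∫ ω, (∑ i, g e i (Y i ω)) ∂ℙ) ≤ c e) :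
    ℙ {ω | (∑ i, w i * ξ i (Y i ω)) ≥ W / 2 ∧
          ∀ e : E, (∑ i, g e i (Y i ω)) ≤ (3 * Real.log m / Real.log (Real.log m)) * c e}
      ≥ ENNReal.ofReal 0.1 := by
  have hindep (f : ∀ i, β i → ℝ) (hf : ∀ i, Measurable (f i)) :
      iIndepFun (fun i ω ↦ f i (Y i ω)) ℙ := hYind.comp f hf
  have hZ : (ℙ : Measure Ω).real {ω | ∑ i, w i * ξ i (Y i ω) < W / 2} ≤ 0.8585 := by
    have hsum (ω) : ∑ i, w i / wmax * ξ i (Y i ω) = (∑ i, w i * ξ i (Y i ω)) / wmax := by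
      rw [Finset.sum_div]
      exact Finset.sum_congr rfl fun i _ ↦ by ring
    have hb := measureReal_sum_le_half_le (hindep (fun i x ↦ w i / wmax * ξ i x)
      fun i ↦ (hξmeas i).const_mul _) (fun i ↦ ((hξmeas i).comp (hYmeas i)).const_mul _)
      fun i ω ↦ by
        have h0 : 0 ≤ w i / wmax := div_nonneg (hw i) hwmax_pos.le
        have h1 : w i / wmax ≤ 1 := (div_le_one hwmax_pos).2 (hwmax_ub i)
        rcases hξval i (Y i ω) with h | h <;> simp [h, h0, h1]
    simp only [hsum, integral_div, ← hW] at hb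
    refine le_trans (measureReal_mono fun ω hω ↦ ?_) (hb.trans
      (exp_neg_half_one_sub_log_two_mul_le ((one_le_div hwmax_pos).2 hWwmax)))
    rw [Set.mem_ofPred_eq] at hω ⊢
    rw [div_right_comm]
    exact div_le_div_of_nonneg_right hω.le hwmax_pos.le
  have hm9' : (9 : ℝ) ≤ m := by exact_mod_cast hm9
  have hlog := one_lt_log_of_nine_le hm9'
  set t := 3 * Real.log m / Real.log (Real.log m)
  have hX (e : E) : (ℙ : Measure Ω).real {ω | t * c e < ∑ i, g e i (Y i ω)} ≤
      Real.exp (-(2 * Real.log m) - 1) := by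
    have hb := measureReal_sum_ge_le (hindep (fun i x ↦ g e i x / c e)
      fun i ↦ (hgmeas e i).div_const _) (fun i ↦ ((hgmeas e i).comp (hYmeas i)).div_const _)
      (fun i ω ↦ ⟨div_nonneg (hgval e i _).1 (hc e).le, (div_le_one (hc e)).2 (hgval e i _).2⟩)
      (by
        simp only [← Finset.sum_div, integral_div]
        exact (div_le_one (hc e)).2 (hgexp e))
      (one_le_three_mul_div_log hlog)
    simp only [← Finset.sum_div] at hb
    refine le_trans (measureReal_mono fun ω hω ↦ ?_) (hb.trans (Real.exp_le_exp.2 ?_))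
    · exact (le_div_iff₀ (hc e)).2 (le_of_lt hω)
    · linarith [two_mul_le_mul_log_sub_one hlog]
  set S := {ω | (∑ i, w i * ξ i (Y i ω)) ≥ W / 2 ∧ ∀ e : E, (∑ i, g e i (Y i ω)) ≤ t * c e}
    with hS
  have hcover : (Set.univ : Set Ω) ⊆ S ∪ ({ω | ∑ i, w i * ξ i (Y i ω) < W / 2} ∪
      ⋃ e, {ω | t * c e < ∑ i, g e i (Y i ω)}) := by
    intro ω _
    by_contra! hω
    simp only [hS, Set.mem_union, Set.mem_iUnion, Set.mem_ofPred_eq, not_or, not_exists,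
      not_lt] at hω
    exact hω.1 ⟨hω.2.1, hω.2.2⟩
  have hunion : (ℙ : Measure Ω).real (⋃ e, {ω | t * c e < ∑ i, g e i (Y i ω)}) ≤ 0.0411 :=
    calc _ ≤ ∑ e, (ℙ : Measure Ω).real {ω | t * c e < ∑ i, g e i (Y i ω)} :=
          measureReal_iUnion_fintype_le _
      _ ≤ ∑ _e : E, Real.exp (-(2 * Real.log m) - 1) := Finset.sum_le_sum fun e _ ↦ hX e
      _ = m * Real.exp (-(2 * Real.log m) - 1) := by simp [hm]
      _ ≤ _ := card_mul_exp_le hm9'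
  have htotal := measureReal_mono (μ := (ℙ : Measure Ω)) hcover
  rw [probReal_univ] at htotal
  have h1 := htotal.trans (measureReal_union_le _ _)
  have h2 := measureReal_union_le (μ := (ℙ : Measure Ω)) {ω | ∑ i, w i * ξ i (Y i ω) < W / 2}
    (⋃ e, {ω | t * c e < ∑ i, g e i (Y i ω)})
  refine (ENNReal.ofReal_le_iff_le_toReal (measure_ne_top _ _)).2 ?_
  change _ ≤ (ℙ : Measure Ω).real S
  linarith
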